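/- For every z∈ℂ, sin_{q²}(z)→sin(z) as q→1⁻, and the convergence is uniform on compact subsets of ℂ: for every compact set K⊆ℂ and every ε>0 there exists δ∈(0,1) such that for all q with 1−δ<q<1 one has sup_{z∈K}|sin_{q²}(z)−sin(z)|<ε. -/

import Mathlib

open Filter Set

/-- The q-number `[n]_q = (1 - qⁿ)/(1 - q)`. -/
noncomputable def qNum (q : ℝ) (n : ℕ) : ℝ := (1 - q ^ n) / (1 - q)

/-- The q-factorial `[n]_q! = [1]_q [2]_q ⋯ [n]_q`, with `[0]_q! = 1`. -/
noncomputable def qFact (q : ℝ) : ℕ → ℝ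
  | 0 => 1
  | n + 1 => qFact q n * qNum q (n + 1)

/-- The q²-sine `sin_{q²}(z) = Σₖ (-1)ᵏ q^{k(k+1)} z^{2k+1}/[2k+1]_q!`. -/
noncomputable def qSin (q : ℝ) (z : ℂ) : ℂ :=
  ∑' k : ℕ, ((-1 : ℂ) ^ k * (q : ℂ) ^ (k * (k + 1)) * z ^ (2 * k + 1)) /
    ((qFact q (2 * k + 1) : ℝ) : ℂ)

open Topology Nat

theorem qNum_eq_geom_sum {q : ℝ} (hq : q ≠ 1) (n : ℕ) :
    qNum q n = ∑ i ∈ Finset.range n, q ^ i := by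
  rw [qNum, geom_sum_eq hq, ← neg_div_neg_eq, neg_sub, neg_sub]

theorem qFact_eq_prod_geom_sum {q : ℝ} (hq : q ≠ 1) (n : ℕ) :
    qFact q n = ∏ j ∈ Finset.range n, ∑ i ∈ Finset.range (j + 1), q ^ i := by
  induction n with
  | zero => simp [qFact]
  | succ n ih => rw [qFact, ih, Finset.prod_range_succ, qNum_eq_geom_sum hq]

theorem qNum_add_two {q : ℝ} (hq : q ≠ 1) (n : ℕ) :
    qNum q (n + 2) = 1 + q * qNum q n + q ^ (n + 1) := by
  have : 1 - q ≠ 0 := sub_ne_zero.mpr hq.symm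
  simp only [qNum]
  field_simp
  ring

theorem two_mul_pow_le_one_add {q : ℝ} (m : ℕ) : 2 * q ^ m ≤ 1 + q ^ (2 * m) := by
  rw [mul_comm 2 m, pow_mul]
  nlinarith [sq_nonneg (1 - q ^ m)]

theorem odd_mul_pow_le_qNum {q : ℝ} (hq : q ∈ Ioo (0 : ℝ) 1) (m : ℕ) :
    (2 * m + 1) * q ^ m ≤ qNum q (2 * m + 1) := by
  induction m with
  | zero => simp [qNum_eq_geom_sum hq.2.ne]
  | succ m ih =>
    rw [show 2 * (m + 1) + 1 = 2 * m + 1 + 2 by ring, qNum_add_two hq.2.ne]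
    have h := two_mul_pow_le_one_add (q := q) (m + 1)
    have h' := mul_le_mul_of_nonneg_left ih hq.1.le
    rw [show 2 * (m + 1) = 2 * m + 1 + 1 by ring] at h
    push_cast
    rw [pow_succ q m] at h ⊢
    linarith

theorem even_mul_pow_le_qNum {q : ℝ} (hq : q ∈ Ioo (0 : ℝ) 1) (m : ℕ) :
    (2 * m) * q ^ m ≤ qNum q (2 * m) := by
  induction m with
  | zero => simp [qNum]
  | succ m ih =>
    rw [show 2 * (m + 1) = 2 * m + 2 by ring, qNum_add_two hq.2.ne]
    have h := two_mul_pow_le_one_add (q := q) (m + 1)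
    have h' := mul_le_mul_of_nonneg_left ih hq.1.le
    have h₂ : q ^ (2 * (m + 1)) ≤ q ^ (2 * m + 1) :=
      pow_le_pow_of_le_one hq.1.le hq.2.le (by omega)
    push_cast
    rw [pow_succ q m] at h ⊢
    linarith

/-- The bound `(2k+1)! q^{k(k+1)} ≤ [2k+1]_q!`, which makes the series of `sin` a majorant. -/
theorem factorial_mul_pow_le_qFact {q : ℝ} (hq : q ∈ Ioo (0 : ℝ) 1) (k : ℕ) :
    ((2 * k + 1)! : ℝ) * q ^ (k * (k + 1)) ≤ qFact q (2 * k + 1) := by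
  induction k with
  | zero => simp [qFact, qNum_eq_geom_sum hq.2.ne]
  | succ k ih =>
    have hq0 := hq.1
    have he := even_mul_pow_le_qNum hq (k + 1)
    have ho := odd_mul_pow_le_qNum hq (k + 1)
    have hF : qFact q (2 * (k + 1) + 1) =
        qFact q (2 * k + 1) * qNum q (2 * (k + 1)) * qNum q (2 * (k + 1) + 1) := rfl
    have hN : ((2 * (k + 1) + 1)! : ℝ) =
        ((2 * k + 1)! : ℝ) * (2 * (k + 1 : ℕ)) * (2 * (k + 1 : ℕ) + 1) := by
      rw [Nat.factorial_succ, show 2 * (k + 1) = 2 * k + 1 + 1 by ring, Nat.factorial_succ]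
      push_cast
      ring
    have he0 : 0 ≤ (2 * (k + 1 : ℕ) : ℝ) * q ^ (k + 1) := by positivity
    have ho0 : 0 ≤ (2 * (k + 1 : ℕ) + 1 : ℝ) * q ^ (k + 1) := by positivity
    have h0 : 0 ≤ ((2 * k + 1)! : ℝ) * q ^ (k * (k + 1)) := by positivity
    rw [hF, hN]
    calc _ = ((2 * k + 1)! : ℝ) * q ^ (k * (k + 1)) * ((2 * (k + 1 : ℕ)) * q ^ (k + 1)) *
          ((2 * (k + 1 : ℕ) + 1) * q ^ (k + 1)) := by ring
      _ ≤ _ := mul_le_mul (mul_le_mul ih he he0 (h0.trans ih)) ho ho0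
          (mul_nonneg (h0.trans ih) (he0.trans he))

theorem qFact_odd_pos {q : ℝ} (hq : q ∈ Ioo (0 : ℝ) 1) (k : ℕ) : 0 < qFact q (2 * k + 1) :=
  lt_of_lt_of_le (by have := hq.1; positivity) (factorial_mul_pow_le_qFact hq k)

theorem pow_div_qFact_le {q : ℝ} (hq : q ∈ Ioo (0 : ℝ) 1) (k : ℕ) :
    q ^ (k * (k + 1)) / qFact q (2 * k + 1) ≤ 1 / ((2 * k + 1)! : ℝ) := by
  rw [div_le_div_iff₀ (qFact_odd_pos hq k) (by positivity), one_mul, mul_comm]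
  exact factorial_mul_pow_le_qFact hq k

theorem tendsto_qFact (n : ℕ) :
    Tendsto (fun q : ℝ => qFact q n) (𝓝[Ioo 0 1] 1) (𝓝 (n ! : ℝ)) := by
  have hc : Continuous fun q : ℝ => ∏ j ∈ Finset.range n, ∑ i ∈ Finset.range (j + 1), q ^ i := by
    fun_prop
  have h := (hc.tendsto 1).mono_left (nhdsWithin_le_nhds (s := Ioo 0 1))
  have h1 : (∏ j ∈ Finset.range n, ∑ i ∈ Finset.range (j + 1), (1 : ℝ) ^ i) = (n ! : ℝ) := by
    simp [← Finset.prod_range_add_one_eq_factorial]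
  rw [h1] at h
  refine h.congr' ?_
  filter_upwards [self_mem_nhdsWithin] with q hq
  exact (qFact_eq_prod_geom_sum hq.2.ne n).symm

theorem tendsto_pow_div_qFact (k : ℕ) :
    Tendsto (fun q : ℝ => q ^ (k * (k + 1)) / qFact q (2 * k + 1)) (𝓝[Ioo 0 1] 1)
      (𝓝 (1 / ((2 * k + 1)! : ℝ))) := by
  have h : Tendsto (fun q : ℝ => q ^ (k * (k + 1))) (𝓝[Ioo 0 1] 1) (𝓝 1) := by
    simpa using ((continuous_pow (k * (k + 1))).tendsto (1 : ℝ)).mono_left nhdsWithin_le_nhds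
  exact h.div (tendsto_qFact _) (by positivity)

theorem summable_pow_div_factorial_odd (R : ℝ) :
    Summable fun k : ℕ => 1 / ((2 * k + 1)! : ℝ) * R ^ (2 * k + 1) := by
  refine ((Real.summable_pow_div_factorial R).comp_injective
    (i := fun k : ℕ => 2 * k + 1) fun a b h => by simpa using h).congr fun k => ?_
  simp only [Function.comp_apply]
  ring

theorem abs_pow_div_qFact_sub_le {q : ℝ} (hq : q ∈ Ioo (0 : ℝ) 1) (k : ℕ) :
    |q ^ (k * (k + 1)) / qFact q (2 * k + 1) - 1 / ((2 * k + 1)! : ℝ)| ≤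
      1 / ((2 * k + 1)! : ℝ) := by
  have h := pow_div_qFact_le hq k
  have h0 : 0 ≤ q ^ (k * (k + 1)) / qFact q (2 * k + 1) :=
    div_nonneg (pow_nonneg hq.1.le _) (qFact_odd_pos hq k).le
  rw [abs_le]
  constructor <;> linarith

theorem norm_qSin_sub_sin_le {q : ℝ} (hq : q ∈ Ioo (0 : ℝ) 1) {R : ℝ} {z : ℂ} (hz : ‖z‖ ≤ R) :
    ‖qSin q z - Complex.sin z‖ ≤ ∑' k : ℕ,
      |q ^ (k * (k + 1)) / qFact q (2 * k + 1) - 1 / ((2 * k + 1)! : ℝ)| * R ^ (2 * k + 1) := by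
  have hR : 0 ≤ R := (norm_nonneg z).trans hz
  have hsum : Summable fun k : ℕ => ((-1 : ℂ) ^ k * (q : ℂ) ^ (k * (k + 1)) * z ^ (2 * k + 1)) /
      ((qFact q (2 * k + 1) : ℝ) : ℂ) := by
    refine .of_norm_bounded (summable_pow_div_factorial_odd R) fun k => ?_
    have h : ‖((-1 : ℂ) ^ k * (q : ℂ) ^ (k * (k + 1)) * z ^ (2 * k + 1)) /
        ((qFact q (2 * k + 1) : ℝ) : ℂ)‖ =
        q ^ (k * (k + 1)) / qFact q (2 * k + 1) * ‖z‖ ^ (2 * k + 1) := by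
      simp only [norm_div, norm_mul, norm_pow, norm_neg, norm_one, one_pow, one_mul,
        Complex.norm_real, Real.norm_eq_abs, abs_of_pos hq.1, abs_of_pos (qFact_odd_pos hq k)]
      ring
    rw [h]
    exact mul_le_mul (pow_div_qFact_le hq k) (pow_le_pow_left₀ (norm_nonneg z) hz _)
      (by positivity) (by positivity)
  have hdiff := hsum.hasSum.sub (Complex.hasSum_sin z)
  have hmaj : Summable fun k : ℕ =>
      |q ^ (k * (k + 1)) / qFact q (2 * k + 1) - 1 / ((2 * k + 1)! : ℝ)| * R ^ (2 * k + 1) :=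
    .of_nonneg_of_le (fun k => by positivity) (fun k => mul_le_mul_of_nonneg_right
      (abs_pow_div_qFact_sub_le hq k) (by positivity)) (summable_pow_div_factorial_odd R)
  rw [qSin, ← hdiff.tsum_eq]
  refine tsum_of_norm_bounded hmaj.hasSum fun k => ?_
  have h : ((-1 : ℂ) ^ k * (q : ℂ) ^ (k * (k + 1)) * z ^ (2 * k + 1)) /
      ((qFact q (2 * k + 1) : ℝ) : ℂ) - (-1) ^ k * z ^ (2 * k + 1) / ((2 * k + 1)! : ℂ) =
      (-1) ^ k * ((q ^ (k * (k + 1)) / qFact q (2 * k + 1) - 1 / ((2 * k + 1)! : ℝ) : ℝ) : ℂ) *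
        z ^ (2 * k + 1) := by
    push_cast
    ring
  rw [h]
  simp only [norm_mul, norm_pow, norm_neg, norm_one, one_pow, one_mul, Complex.norm_real,
    Real.norm_eq_abs]
  gcongr

theorem tendsto_tsum_abs_pow_div_qFact_sub {R : ℝ} (hR : 0 ≤ R) :
    Tendsto (fun q : ℝ => ∑' k : ℕ,
      |q ^ (k * (k + 1)) / qFact q (2 * k + 1) - 1 / ((2 * k + 1)! : ℝ)| * R ^ (2 * k + 1))
      (𝓝[Ioo 0 1] 1) (𝓝 0) := by
  suffices h : Tendsto (fun q : ℝ => ∑' k : ℕ,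
      |q ^ (k * (k + 1)) / qFact q (2 * k + 1) - 1 / ((2 * k + 1)! : ℝ)| * R ^ (2 * k + 1))
      (𝓝[Ioo 0 1] 1) (𝓝 (∑' _ : ℕ, (0 : ℝ))) by simpa only [tsum_zero] using h
  refine tendsto_tsum_of_dominated_convergence (summable_pow_div_factorial_odd R)
    (fun k => ?_) ?_
  · simpa using (((tendsto_pow_div_qFact k).sub_const (1 / ((2 * k + 1)! : ℝ))).abs).mul_const
      (R ^ (2 * k + 1))
  · filter_upwards [self_mem_nhdsWithin] with q hq k
    rw [Real.norm_of_nonneg (by positivity)]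
    exact mul_le_mul_of_nonneg_right (abs_pow_div_qFact_sub_le hq k) (by positivity)

/-- **`sin_{q²} → sin` as `q → 1⁻`, uniformly on compact subsets of `ℂ`:**
for every `z ∈ ℂ`, `sin_{q²}(z) → sin z` as `q → 1⁻`, and for every compact `K ⊆ ℂ` and
`ε > 0` there is `δ ∈ (0,1)` such that `sup_{z ∈ K} |sin_{q²}(z) - sin z| < ε` whenever
`1 - δ < q < 1`. -/
theorem qSin_tendsto_sin :
    (∀ z : ℂ, Tendsto (fun q : ℝ => qSin q z) (nhdsWithin 1 (Ioo 0 1))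
      (nhds (Complex.sin z))) ∧
    ∀ K : Set ℂ, IsCompact K → ∀ ε > (0 : ℝ), ∃ δ ∈ Ioo (0 : ℝ) 1,
      ∀ q : ℝ, 1 - δ < q → q < 1 → ∀ z ∈ K, ‖qSin q z - Complex.sin z‖ < ε := by
  constructor
  · intro z
    rw [tendsto_iff_norm_sub_tendsto_zero]
    refine squeeze_zero' (.of_forall fun _ => norm_nonneg _) ?_
      (tendsto_tsum_abs_pow_div_qFact_sub (norm_nonneg z))
    filter_upwards [self_mem_nhdsWithin] with q hq
    exact norm_qSin_sub_sin_le hq le_rfl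
  · intro K hK ε hε
    obtain ⟨R, hR, hKR⟩ := hK.isBounded.exists_pos_norm_le
    have hev := (tendsto_tsum_abs_pow_div_qFact_sub hR.le).eventually_lt_const hε
    obtain ⟨δ, hδ, hball⟩ := Metric.mem_nhdsWithin_iff.mp hev
    refine ⟨min δ (1 / 2), ⟨by positivity, by linarith [min_le_right δ (1 / 2)]⟩, ?_⟩
    intro q hq hq1 z hz
    have hq0 : q ∈ Ioo (0 : ℝ) 1 := ⟨by linarith [min_le_right δ (1 / 2)], hq1⟩
    refine (norm_qSin_sub_sin_le hq0 (hKR z hz)).trans_lt (hball ⟨?_, hq0⟩)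
    rw [Metric.mem_ball, Real.dist_eq, abs_lt]
    constructor <;> linarith [min_le_left δ (1 / 2)]
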